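/- arXiv:2410.17121 — 2 statements merged into one kernel-verified Lean document; each statement's English description precedes it below -/
import Mathlib

section
/- The complex of partial bases B₂ of the free group F₂ (vertices: conjugacy classes of primitive elements; edges: pairs {[v₁],[v₂]} with {v₁,v₂} a basis of F₂) is connected. -/
open scoped Classical

noncomputable section

universe u v

/-- `F n` is the free group of rank `n`. -/
abbrev FG (n : ℕ) : Type := FreeGroup (Fin n)

/-- `b : Fin n → FG n` is a basis of the free group of rank `n`. -/
def IsBasisFG {n : ℕ} (b : Fin n → FG n) : Prop :=
  Function.Bijective ⇑(FreeGroup.lift b)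

/-- An element of the free group is primitive if it belongs to some basis. -/
def PrimitiveFG {n : ℕ} (v : FG n) : Prop :=
  ∃ b : Fin n → FG n, IsBasisFG b ∧ v ∈ Set.range b

/-- Adjacency in the complex of partial bases `B 2`: two conjugacy classes span
an edge if they have representatives forming a basis of `F₂`. -/
def basisAdj (c d : ConjClasses (FG 2)) : Prop :=
  ∃ b : Fin 2 → FG 2, IsBasisFG b ∧
    ((c = ConjClasses.mk (b 0) ∧ d = ConjClasses.mk (b 1)) ∨
     (c = ConjClasses.mk (b 1) ∧ d = ConjClasses.mk (b 0)))

namespace FreeGroup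

variable {α : Type*} [DecidableEq α]

/-- The length of the longest common prefix of two words. -/
def commonPrefixLength : List (α × Bool) → List (α × Bool) → ℕ
  | a :: s, b :: t => if a = b then commonPrefixLength s t + 1 else 0
  | [], _ => 0
  | _ :: _, [] => 0

theorem min_commonPrefixLength_le (s t u : List (α × Bool)) :
    min (commonPrefixLength s t) (commonPrefixLength t u) ≤ commonPrefixLength s u := by
  induction s generalizing t u with
  | nil => simp [commonPrefixLength]
  | cons a s ih =>
    rcases t with - | ⟨b, t⟩
    · simp [commonPrefixLength]
    · rcases u with - | ⟨c, u⟩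
      · simp [commonPrefixLength]
      · have := ih t u
        simp only [commonPrefixLength]
        grind

theorem take_eq_take_of_le_commonPrefixLength {s t : List (α × Bool)} {k : ℕ}
    (h : k ≤ commonPrefixLength s t) : s.take k = t.take k := by
  induction s generalizing t k with
  | nil => simp_all [commonPrefixLength]
  | cons a s ih =>
    rcases t with - | ⟨b, t⟩
    · simp_all [commonPrefixLength]
    · rcases k with - | k
      · simp
      · simp only [commonPrefixLength] at h
        split_ifs at h with hab
        · simp [hab, ih (Nat.le_of_succ_le_succ h)]
        · omega

theorem IsReduced.norm_mk {L : List (α × Bool)} (h : IsReduced L) : norm (mk L) = L.length := by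
  rw [norm, toWord_mk, h.reduce_eq]

theorem IsReduced.invRev {L : List (α × Bool)} (h : IsReduced L) : IsReduced (invRev L) := by
  rw [isReduced_iff_reduce_eq, reduce_invRev, h.reduce_eq]

theorem IsReduced.norm_inv_mk_mul_mk {s t : List (α × Bool)} (hs : IsReduced s)
    (ht : IsReduced t) :
    norm ((mk s)⁻¹ * mk t) + 2 * commonPrefixLength s t = s.length + t.length := by
  induction s generalizing t with
  | nil => simpa [commonPrefixLength, ← one_eq_mk] using ht.norm_mk
  | cons a s ih =>
    rcases t with - | ⟨b, t⟩
    · simpa [commonPrefixLength, ← one_eq_mk, -inv_mk, norm_inv_eq] using hs.norm_mk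
    · by_cases hab : a = b
      · subst hab
        have := ih (t := t) (List.IsChain.tail hs) (List.IsChain.tail ht)
        have e : (mk (a :: s))⁻¹ * mk (a :: t) = (mk s)⁻¹ * mk t := by
          rw [← List.singleton_append, ← List.singleton_append (l := t), ← mul_mk, ← mul_mk]
          group
        simp only [commonPrefixLength, e, if_true, List.length_cons]
        omega
      · have hr : IsReduced (FreeGroup.invRev (a :: s) ++ b :: t) := by
          refine List.isChain_append.2 ⟨hs.invRev, ht, ?_⟩
          rcases a with ⟨a, p⟩
          rcases b with ⟨b, q⟩
          simp [FreeGroup.invRev]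
          rintro rfl
          cases p <;> cases q <;> simp_all
        rw [inv_mk, mul_mk, hr.norm_mk]
        simp [commonPrefixLength, hab]

/-- The Gromov product of two elements of a free group, based at the identity. -/
def gromovProduct (g h : FreeGroup α) : ℕ := commonPrefixLength g.toWord h.toWord

theorem norm_inv_mul_add (g h : FreeGroup α) :
    norm (g⁻¹ * h) + 2 * gromovProduct g h = norm g + norm h := by
  have := (isReduced_toWord (x := g)).norm_inv_mk_mul_mk (isReduced_toWord (x := h))
  rwa [mk_toWord, mk_toWord] at this

theorem norm_mul_add (g h : FreeGroup α) :
    norm (g * h) + 2 * gromovProduct g⁻¹ h = norm g + norm h := by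
  simpa using norm_inv_mul_add g⁻¹ h

theorem gromovProduct_comm (g h : FreeGroup α) : gromovProduct g h = gromovProduct h g := by
  have h₁ := norm_inv_mul_add g h
  have h₂ := norm_inv_mul_add h g
  have h₃ := norm_inv_eq (x := g⁻¹ * h)
  rw [mul_inv_rev, inv_inv] at h₃
  omega

theorem min_gromovProduct_le (g h k : FreeGroup α) :
    min (gromovProduct g h) (gromovProduct h k) ≤ gromovProduct g k :=
  min_commonPrefixLength_le _ _ _

theorem norm_lt_norm_mul_self {g : FreeGroup α} (hg : g ≠ 1) : norm g < norm (g * g) := by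
  have hne : reduceCyclically g.toWord ≠ [] := by
    intro h
    have e := reduceCyclically.conj_conjugator_reduceCyclically g.toWord
    rw [h, List.append_nil] at e
    apply hg
    rw [← mk_toWord (x := g), ← e, ← mul_mk, ← inv_mk, mul_inv_cancel]
  have e₁ := congrArg List.length
    (reduceCyclically.conj_conjugator_reduceCyclically g.toWord)
  have e₂ := congrArg List.length (reduceCyclically.reduce_flatten_replicate
    (isReduced_toWord (x := g)) 2)
  rw [← toWord_pow, pow_two] at e₂
  have := List.length_pos_of_ne_nil hne
  simp [List.replicate] at e₁ e₂
  simp only [norm]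
  omega

theorem gromovProduct_inv_self_lt {g : FreeGroup α} (hg : g ≠ 1) :
    2 * gromovProduct g⁻¹ g < norm g := by
  have h₁ := norm_mul_add g g
  have h₂ := norm_lt_norm_mul_self hg
  omega

theorem mk_take_invRev {β : Type*} {L : List (β × Bool)} {k : ℕ} :
    mk ((invRev L).take k) = (mk (L.drop (L.length - k)))⁻¹ := by
  rw [inv_mk]
  congr 1
  simp [invRev, List.take_reverse, List.map_drop]

theorem exists_eq_of_gromovProduct {u v : FreeGroup α} {k : ℕ} (hv : norm v = 2 * k)
    (hu : 2 * k ≤ norm u) (huv : k ≤ gromovProduct u⁻¹ v) (hvu : k ≤ gromovProduct v⁻¹ u) :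
    ∃ a m c : FreeGroup α, u = a * m * c⁻¹ ∧ v = c * a⁻¹ ∧ norm a ≤ k ∧ norm c ≤ k ∧
      norm m + 2 * k ≤ norm u := by
  have h₁ := take_eq_take_of_le_commonPrefixLength huv
  have h₂ := take_eq_take_of_le_commonPrefixLength hvu
  rw [toWord_inv] at h₁ h₂
  have h₁' := congrArg mk h₁
  have h₂' := congrArg mk h₂
  rw [mk_take_invRev] at h₁' h₂'
  have lv : v.toWord.length = 2 * k := hv
  have lu : 2 * k ≤ u.toWord.length := hu
  have ev : v.toWord.length - k = k := by omega
  rw [ev] at h₂'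
  refine ⟨mk (u.toWord.take k), mk ((u.toWord.take (u.toWord.length - k)).drop k),
    mk (v.toWord.take k), ?_, ?_, ?_, ?_, ?_⟩
  · rw [← h₁', inv_inv, mul_mk, mul_mk]
    have : u.toWord.take k = (u.toWord.take (u.toWord.length - k)).take k := by
      rw [List.take_take]
      congr 1
      omega
    rw [this, List.take_append_drop, List.take_append_drop, mk_toWord]
  · rw [← h₂', inv_inv, mul_mk, List.take_append_drop, mk_toWord]
  · exact norm_mk_le.trans (by simp)
  · exact norm_mk_le.trans (by simp)
  · have : norm (mk ((u.toWord.take (u.toWord.length - k)).drop k)) ≤ _ := norm_mk_le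
    simp only [List.length_drop, List.length_take] at this
    simp only [norm] at *
    omega

section NielsenReduced

variable {ι : Type*} {f : ι → FreeGroup α} {R : ι → ι → Prop}

theorem gromovProduct_inv_prod_of_isChain
    (hf : ∀ i j k, R i j → R j k →
      gromovProduct (f i)⁻¹ (f j) + gromovProduct (f j)⁻¹ (f k) < norm (f j))
    (i j : ι) (L : List ι) (h : (i :: j :: L).IsChain R) :
    gromovProduct (f i)⁻¹ ((j :: L).map f).prod = gromovProduct (f i)⁻¹ (f j) := by
  induction L generalizing i j with
  | nil => simp
  | cons k L ih =>
    have hij := (List.isChain_cons_cons.1 h).1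
    have hjk := (List.isChain_cons_cons.1 (List.isChain_cons_cons.1 h).2).1
    have h₁ := ih j k (List.isChain_cons_cons.1 h).2
    have h₂ := hf i j k hij hjk
    rw [List.map_cons, List.prod_cons]
    set P := ((k :: L).map f).prod
    have h₃ := norm_mul_add (f j) P
    have h₄ := norm_inv_mul_add (f j) (f j * P)
    rw [inv_mul_cancel_left] at h₄
    have h₅ := min_gromovProduct_le (f i)⁻¹ (f j) (f j * P)
    have h₆ := min_gromovProduct_le (f i)⁻¹ (f j * P) (f j)
    rw [gromovProduct_comm (f j * P)] at h₆
    omega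

/-- A reduced product of at least two letters of a Nielsen reduced family has length at least
two. -/
theorem two_le_norm_prod_of_isChain
    (hf : ∀ i j k, R i j → R j k →
      gromovProduct (f i)⁻¹ (f j) + gromovProduct (f j)⁻¹ (f k) < norm (f j))
    (hl : ∀ i j, R i j → gromovProduct (f i)⁻¹ (f j) < norm (f i))
    (hr : ∀ i j, R i j → gromovProduct (f i)⁻¹ (f j) < norm (f j))
    (i j : ι) (L : List ι) (h : (i :: j :: L).IsChain R) :
    2 ≤ norm ((i :: j :: L).map f).prod := by
  suffices H : norm (f i) - gromovProduct (f i)⁻¹ (f j) + 1 ≤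
      norm ((i :: j :: L).map f).prod by
    have := hl i j (List.isChain_cons_cons.1 h).1
    omega
  induction L generalizing i j with
  | nil =>
    have hij := (List.isChain_cons_cons.1 h).1
    have := norm_mul_add (f i) (f j)
    have := hl i j hij
    have := hr i j hij
    simp only [List.map_cons, List.map_nil, List.prod_cons, List.prod_nil, mul_one]
    omega
  | cons k L ih =>
    have hij := (List.isChain_cons_cons.1 h).1
    have hjk := (List.isChain_cons_cons.1 (List.isChain_cons_cons.1 h).2).1
    have h₁ := ih j k (List.isChain_cons_cons.1 h).2
    have h₂ := hf i j k hij hjk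
    have h₃ := gromovProduct_inv_prod_of_isChain hf i j (k :: L) h
    have h₄ := hl i j hij
    rw [List.map_cons, List.prod_cons]
    have h₅ := norm_mul_add (f i) ((j :: k :: L).map f).prod
    omega

end NielsenReduced

end FreeGroup

open FreeGroup

theorem IsBasisFG.comp_mulEquiv {n : ℕ} {b : Fin n → FG n} (hb : IsBasisFG b)
    (e : FG n ≃* FG n) : IsBasisFG fun i => e (b i) := by
  have : ⇑(FreeGroup.lift fun i => e (b i)) = e ∘ FreeGroup.lift b := by
    have : FreeGroup.lift (fun i => e (b i)) = e.toMonoidHom.comp (FreeGroup.lift b) := by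
      ext i
      simp
    rw [this]
    rfl
  rw [IsBasisFG, this]
  exact e.bijective.comp hb

theorem IsBasisFG.of_substitution {n : ℕ} {b b' : Fin n → FG n} (hb : IsBasisFG b)
    (s t : Fin n → FG n) (hst : ∀ i, FreeGroup.lift s (t i) = of i)
    (hts : ∀ i, FreeGroup.lift t (s i) = of i) (hb' : ∀ i, b' i = FreeGroup.lift b (s i)) :
    IsBasisFG b' := by
  have e : FreeGroup.lift b' = (FreeGroup.lift b).comp (FreeGroup.lift s) := by
    ext i
    simp [hb']
  have h₁ : (FreeGroup.lift s).comp (FreeGroup.lift t) = MonoidHom.id _ := by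
    ext i
    simp [hst]
  have h₂ : (FreeGroup.lift t).comp (FreeGroup.lift s) = MonoidHom.id _ := by
    ext i
    simp [hts]
  rw [IsBasisFG, e, MonoidHom.coe_comp]
  exact hb.comp (Function.bijective_iff_has_inverse.2
    ⟨FreeGroup.lift t, DFunLike.congr_fun h₂, DFunLike.congr_fun h₁⟩)

section RankTwo

variable {x y : FG 2}

theorem IsBasisFG.swap (h : IsBasisFG ![x, y]) : IsBasisFG ![y, x] :=
  h.of_substitution ![of 1, of 0] ![of 1, of 0] (by simp [Fin.forall_fin_two])
    (by simp [Fin.forall_fin_two]) (by simp [Fin.forall_fin_two])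

theorem IsBasisFG.inv_left (h : IsBasisFG ![x, y]) : IsBasisFG ![x⁻¹, y] :=
  h.of_substitution ![(of 0)⁻¹, of 1] ![(of 0)⁻¹, of 1] (by simp [Fin.forall_fin_two])
    (by simp [Fin.forall_fin_two]) (by simp [Fin.forall_fin_two])

theorem IsBasisFG.mul_left (h : IsBasisFG ![x, y]) : IsBasisFG ![x * y, y] :=
  h.of_substitution ![of 0 * of 1, of 1] ![of 0 * (of 1)⁻¹, of 1] (by simp [Fin.forall_fin_two])
    (by simp [Fin.forall_fin_two]) (by simp [Fin.forall_fin_two])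

theorem IsBasisFG.conj (h : IsBasisFG ![x, y]) (g : FG 2) :
    IsBasisFG ![g * x * g⁻¹, g * y * g⁻¹] := by
  convert h.comp_mulEquiv (MulAut.conj g) using 1
  funext i
  fin_cases i <;> simp

theorem IsBasisFG.ne_one {n : ℕ} {b : Fin n → FG n} (h : IsBasisFG b) (i : Fin n) : b i ≠ 1 := by
  intro hi
  exact of_ne_one i (h.1 (by simpa using hi))

theorem IsBasisFG.basisAdj (h : IsBasisFG ![x, y]) :
    basisAdj (ConjClasses.mk x) (ConjClasses.mk y) :=
  ⟨_, h, Or.inl ⟨rfl, rfl⟩⟩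

theorem basisAdj.symm {c d : ConjClasses (FG 2)} (h : basisAdj c d) : basisAdj d c := by
  obtain ⟨b, hb, h | h⟩ := h
  exacts [⟨b, hb, Or.inr h.symm⟩, ⟨b, hb, Or.inl h.symm⟩]

theorem reflTransGen_basisAdj_symm {c d : ConjClasses (FG 2)}
    (h : Relation.ReflTransGen basisAdj c d) : Relation.ReflTransGen basisAdj d c :=
  have : Std.Symm basisAdj := ⟨fun _ _ => basisAdj.symm⟩
  Relation.ReflTransGen.stdSymm.symm _ _ h

/-- The conjugacy class of `g` can be joined to that of the first standard generator. -/
def ConnectedToGenerator (g : FG 2) : Prop :=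
  Relation.ReflTransGen basisAdj (ConjClasses.mk g) (ConjClasses.mk (of 0))

theorem IsBasisFG.connectedToGenerator (h : IsBasisFG ![x, y]) (hy : ConnectedToGenerator y) :
    ConnectedToGenerator x :=
  Relation.ReflTransGen.head h.basisAdj hy

theorem ConnectedToGenerator.of_conj {g : FG 2} (h : ConnectedToGenerator (g * x * g⁻¹)) :
    ConnectedToGenerator x := by
  rwa [ConnectedToGenerator, ConjClasses.mk_eq_mk_iff_isConj.2 (isConj_iff.2 ⟨g, rfl⟩)]

/-- A basis not joined to the standard generator, all of whose shorter bases are. -/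
structure MinimalUnconnected (x y : FG 2) : Prop where
  basis : IsBasisFG ![x, y]
  not_connected : ¬ ConnectedToGenerator x
  minimal : ∀ x' y', IsBasisFG ![x', y'] → norm x' + norm y' < norm x + norm y →
    ConnectedToGenerator x'

namespace MinimalUnconnected

theorem swap (h : MinimalUnconnected x y) : MinimalUnconnected y x where
  basis := h.basis.swap
  not_connected hy := h.not_connected (h.basis.connectedToGenerator hy)
  minimal x' y' hb hl := h.minimal x' y' hb (by omega)

theorem inv_left (h : MinimalUnconnected x y) : MinimalUnconnected x⁻¹ y where
  basis := h.basis.inv_left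
  not_connected hx := h.not_connected
    (h.basis.connectedToGenerator (h.basis.inv_left.swap.connectedToGenerator hx))
  minimal x' y' hb hl := h.minimal x' y' hb (by rwa [norm_inv_eq] at hl)

theorem inv_right (h : MinimalUnconnected x y) : MinimalUnconnected x y⁻¹ :=
  h.swap.inv_left.swap

theorem not_connected_right (h : MinimalUnconnected x y) : ¬ ConnectedToGenerator y :=
  h.swap.not_connected

theorem left_ne_one (h : MinimalUnconnected x y) : x ≠ 1 := h.basis.ne_one 0

theorem norm_left_pos (h : MinimalUnconnected x y) : 0 < norm x :=
  Nat.pos_of_ne_zero (norm_eq_zero.not.2 h.left_ne_one)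

theorem norm_le_norm_mul (h : MinimalUnconnected x y) : norm x ≤ norm (x * y) := by
  by_contra! hlt
  exact h.not_connected_right (h.basis.mul_left.swap.connectedToGenerator
    (h.minimal _ _ h.basis.mul_left (by omega)))

theorem two_mul_gromovProduct_le_right (h : MinimalUnconnected x y) :
    2 * gromovProduct x⁻¹ y ≤ norm y := by
  have := h.norm_le_norm_mul
  have := norm_mul_add x y
  omega

theorem two_mul_gromovProduct_le_left (h : MinimalUnconnected x y) :
    2 * gromovProduct x⁻¹ y ≤ norm x := by
  simpa [gromovProduct_comm] using h.inv_left.swap.inv_left.two_mul_gromovProduct_le_right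

theorem gromovProduct_add_lt_inv (h : MinimalUnconnected x y) :
    gromovProduct x⁻¹ y + gromovProduct y⁻¹ x⁻¹ < norm y := by
  have h₁ := gromovProduct_inv_self_lt h.swap.left_ne_one
  have h₂ := h.two_mul_gromovProduct_le_right
  have h₃ := h.inv_left.swap.two_mul_gromovProduct_le_left
  have h₄ := min_gromovProduct_le y⁻¹ x⁻¹ y
  omega

theorem gromovProduct_add_lt (h : MinimalUnconnected x y) :
    gromovProduct x⁻¹ y + gromovProduct y⁻¹ x < norm y := by
  by_contra! hge
  have h₁ := h.two_mul_gromovProduct_le_right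
  have h₂ := h.swap.two_mul_gromovProduct_le_left
  have h₃ := h.two_mul_gromovProduct_le_left
  have hpos := h.swap.norm_left_pos
  obtain ⟨a, m, c, hx, hy, ha, hc, hm⟩ := exists_eq_of_gromovProduct (u := x) (v := y)
    (k := gromovProduct x⁻¹ y) (by omega) (by omega) le_rfl (by omega)
  have hb := h.basis.mul_left.conj a⁻¹
  have e₁ : a⁻¹ * (x * y) * a⁻¹⁻¹ = m := by rw [hx, hy]; group
  have e₂ : a⁻¹ * y * a⁻¹⁻¹ = a⁻¹ * c := by rw [hy]; group
  have hlen : norm (a⁻¹ * c) ≤ norm a + norm c := by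
    simpa using norm_mul_le a⁻¹ c
  have hconn := h.minimal _ _ hb (by rw [e₁, e₂]; omega)
  exact h.not_connected_right
    (h.basis.mul_left.swap.connectedToGenerator hconn.of_conj)

end MinimalUnconnected

/-- The element of `{x, x⁻¹, y, y⁻¹}` denoted by a letter. -/
def letterValue (x y : FG 2) (i : Fin 2 × Bool) : FG 2 :=
  cond i.2 (![x, y] i.1) (![x, y] i.1)⁻¹

namespace MinimalUnconnected

theorem pair_letterValue (h : MinimalUnconnected x y) {i j : Fin 2 × Bool} (hij : i.1 ≠ j.1) :
    MinimalUnconnected (letterValue x y i) (letterValue x y j) := by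
  obtain ⟨i, p⟩ := i
  obtain ⟨j, q⟩ := j
  have h' := h.swap
  fin_cases i <;> fin_cases j <;> cases p <;> cases q <;>
    simp_all [letterValue, inv_left, inv_right]

theorem letterValue_ne_one (h : MinimalUnconnected x y) (i : Fin 2 × Bool) :
    letterValue x y i ≠ 1 :=
  (h.pair_letterValue (i := i) (j := (i.1 + 1, true)) (by simp)).left_ne_one

theorem gromovProduct_letterValue_le (h : MinimalUnconnected x y) {i j : Fin 2 × Bool}
    (hij : i.1 = j.1 → i.2 = j.2) :
    2 * gromovProduct (letterValue x y i)⁻¹ (letterValue x y j) ≤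
        norm (letterValue x y i) ∧
      2 * gromovProduct (letterValue x y i)⁻¹ (letterValue x y j) ≤
        norm (letterValue x y j) := by
  by_cases hne : i.1 = j.1
  · obtain rfl : i = j := Prod.ext hne (hij hne)
    have := gromovProduct_inv_self_lt (h.letterValue_ne_one i)
    omega
  · exact ⟨(h.pair_letterValue hne).two_mul_gromovProduct_le_left,
      (h.pair_letterValue hne).two_mul_gromovProduct_le_right⟩

theorem gromovProduct_letterValue_add_lt (h : MinimalUnconnected x y) (i j k : Fin 2 × Bool)
    (hij : i.1 = j.1 → i.2 = j.2) (hjk : j.1 = k.1 → j.2 = k.2) :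
    gromovProduct (letterValue x y i)⁻¹ (letterValue x y j) +
      gromovProduct (letterValue x y j)⁻¹ (letterValue x y k) <
        norm (letterValue x y j) := by
  have h₁ := (h.gromovProduct_letterValue_le hij).2
  have h₂ := (h.gromovProduct_letterValue_le hjk).1
  have h₃ := gromovProduct_inv_self_lt (h.letterValue_ne_one j)
  by_cases hne₁ : i.1 = j.1
  · obtain rfl : i = j := Prod.ext hne₁ (hij hne₁)
    omega
  by_cases hne₂ : j.1 = k.1
  · obtain rfl : j = k := Prod.ext hne₂ (hjk hne₂)
    omega
  have hik : i.1 = k.1 := by omega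
  by_cases hs : i.2 = k.2
  · obtain rfl : i = k := Prod.ext hik hs
    exact (h.pair_letterValue hne₁).gromovProduct_add_lt
  · have e : letterValue x y k = (letterValue x y i)⁻¹ := by
      obtain ⟨i, p⟩ := i
      obtain ⟨k, q⟩ := k
      obtain rfl : i = k := hik
      cases p <;> cases q <;> simp_all [letterValue]
    rw [e]
    exact (h.pair_letterValue hne₁).gromovProduct_add_lt_inv

end MinimalUnconnected

theorem not_minimalUnconnected (x y : FG 2) : ¬ MinimalUnconnected x y := by
  intro h
  obtain ⟨w, hw⟩ := h.basis.2 (of 0)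
  have hred := isReduced_toWord (x := w)
  rw [← mk_toWord (x := w), lift_mk] at hw
  change (w.toWord.map (letterValue x y)).prod = of 0 at hw
  generalize w.toWord = L at hw hred
  match L with
  | [] => exact one_ne_of 0 hw
  | [i] =>
    rw [List.map_singleton, List.prod_singleton] at hw
    apply (h.pair_letterValue (i := i) (j := (i.1 + 1, true)) (by simp)).not_connected
    rw [hw]
    exact Relation.ReflTransGen.refl
  | i :: j :: L =>
    have hpos (i : Fin 2 × Bool) : 0 < norm (letterValue x y i) :=
      Nat.pos_of_ne_zero (norm_eq_zero.not.2 (h.letterValue_ne_one i))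
    have := two_le_norm_prod_of_isChain h.gromovProduct_letterValue_add_lt
      (fun i j hij => by
        have := (h.gromovProduct_letterValue_le hij).1
        have := hpos i
        omega)
      (fun i j hij => by
        have := (h.gromovProduct_letterValue_le hij).2
        have := hpos j
        omega) i j L hred
    rw [hw, norm_of] at this
    omega

theorem IsBasisFG.connectedToGenerator_left (h : IsBasisFG ![x, y]) : ConnectedToGenerator x := by
  induction hn : norm x + norm y using Nat.strong_induction_on generalizing x y with
  | _ n ih =>
    by_contra hx
    exact not_minimalUnconnected x y
      ⟨h, hx, fun x' y' hb hl => ih _ (hn ▸ hl) hb rfl⟩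

theorem PrimitiveFG.connectedToGenerator {v : FG 2} (h : PrimitiveFG v) :
    ConnectedToGenerator v := by
  obtain ⟨b, hb, i, rfl⟩ := h
  have hb' : IsBasisFG ![b 0, b 1] := by
    convert hb using 1
    funext i
    fin_cases i <;> rfl
  fin_cases i
  exacts [hb'.connectedToGenerator_left, hb'.swap.connectedToGenerator_left]

end RankTwo

/-- The complex of partial bases `B₂` of the free group `F₂`
is connected: any two vertices (conjugacy classes of primitive elements) are
joined by a path of edges. -/
theorem partialBasisComplex_two_connected
    (c d : ConjClasses (FG 2))
    (hc : ∃ v : FG 2, PrimitiveFG v ∧ c = ConjClasses.mk v)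
    (hd : ∃ v : FG 2, PrimitiveFG v ∧ d = ConjClasses.mk v) :
    Relation.ReflTransGen basisAdj c d := by
  obtain ⟨v, hv, rfl⟩ := hc
  obtain ⟨w, hw, rfl⟩ := hd
  exact hv.connectedToGenerator.trans (reflTransGen_basisAdj_symm hw.connectedToGenerator)
end
end

section
/- Let P and Q be posets each having order complex homotopy equivalent to a wedge of spheres of dimensions p and q respectively (p, q ≥ 0, possibly trivial wedges). Let R = ((P ∪ {0̂_P}) × (Q ∪ {0̂_Q})) ∖ {(0̂_P, 0̂_Q)}, where 0̂ denotes a new minimum element adjoined. Then the order complex of R is homotopy equivalent to the join of the order complexes of P and Q. -/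
open scoped Classical

noncomputable section

universe u v

/-- An abstract simplicial complex on a vertex type `V`, given by its set of
faces (finite subsets of `V`), closed under taking subsets. -/
structure AbsSC (V : Type u) where
  faces : Set (Finset V)
  down_closed : ∀ s ∈ faces, ∀ t ⊆ s, t ∈ faces

namespace AbsSC

/-- The geometric realization of an abstract simplicial complex: the space of
convex-combination functions supported on a face of the complex. -/
def realization {V : Type u} (K : AbsSC V) : Type u :=
  {f : V → ℝ // ∃ s ∈ K.faces, (∀ v ∉ s, f v = 0) ∧ (∀ v, 0 ≤ f v) ∧ ∑ v ∈ s, f v = 1}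

instance {V : Type u} (K : AbsSC V) : TopologicalSpace (realization K) :=
  inferInstanceAs (TopologicalSpace {_f : V → ℝ // _})

end AbsSC

/-- The order complex of a poset: its simplices are the finite chains. -/
def orderComplex (X : Type u) [Preorder X] : AbsSC X where
  faces := {s | IsChain (· ≤ ·) (↑s : Set X)}
  down_closed := fun _s hs _t hts => hs.mono (Finset.coe_subset.mpr hts)

/-- `n`-connectedness of a topological space: every space is `n`-connected for
`n ≤ -2`, a space is `(-1)`-connected iff it is non-empty, and for `n ≥ 0` it is
`n`-connected iff it is non-empty and all homotopy groups in degrees `≤ n` vanish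
(for every basepoint). -/
def NConnected (n : ℤ) (X : Type u) [TopologicalSpace X] : Prop :=
  (-1 ≤ n → Nonempty X) ∧
    ∀ m : ℕ, (m : ℤ) ≤ n → ∀ x : X, Subsingleton (HomotopyGroup (Fin m) X x)

/-- A basepoint on the `n`-sphere. -/
def spherePt (n : ℕ) : Metric.sphere (0 : EuclideanSpace ℝ (Fin (n+1))) 1 :=
  ⟨(NormedSpace.sphere_nonempty.mpr zero_le_one).choose,
    (NormedSpace.sphere_nonempty.mpr zero_le_one).choose_spec⟩

/-- The wedge of `ι`-many `n`-spheres: the disjoint union of the spheres with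
their basepoints identified. -/
def SphereWedge (ι : Type) (n : ℕ) : Type :=
  Quot (fun a b : ι × (Metric.sphere (0 : EuclideanSpace ℝ (Fin (n+1))) 1) =>
    a.2 = spherePt n ∧ b.2 = spherePt n)

instance (ι : Type) (n : ℕ) : TopologicalSpace (SphereWedge ι n) :=
  letI : TopologicalSpace ι := ⊥
  inferInstanceAs (TopologicalSpace (Quot _))

/-- `X` has the homotopy type of a wedge of `d`-spheres, with the conventions
that a point is a (trivial) wedge of `d`-spheres for every `d`, and that for
`d < 0` a non-trivial wedge of `d`-spheres is the empty space. -/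
def IsWedgeOfSpheres (d : ℤ) (X : Type u) [TopologicalSpace X] : Prop :=
  ContractibleSpace X ∨ (d < 0 ∧ IsEmpty X) ∨
    (0 ≤ d ∧ ∃ ι : Type, Nonempty ι ∧
      Nonempty (ContinuousMap.HomotopyEquiv X (SphereWedge ι d.toNat)))

/-- The join `K ∗ L` of two simplicial complexes, on the disjoint union of
their vertex sets: faces are unions of a face of `K` and a face of `L`. -/
def joinComplex {V : Type u} {W : Type v} (K : AbsSC V) (L : AbsSC W) :
    AbsSC (V ⊕ W) where
  faces := {s | s.toLeft ∈ K.faces ∧ s.toRight ∈ L.faces}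
  down_closed := by
    rintro s ⟨h1, h2⟩ t hts
    constructor
    · exact K.down_closed _ h1 _ (fun a ha => by
        rw [Finset.mem_toLeft] at ha ⊢; exact hts ha)
    · exact L.down_closed _ h2 _ (fun a ha => by
        rw [Finset.mem_toRight] at ha ⊢; exact hts ha)

namespace AbsSC

variable {V : Type u} {W : Type v} {K : AbsSC V} {L : AbsSC W}

/-- The barycentric coordinates of a point of the realization. -/
def realization.coord (f : realization K) : V → ℝ := f.1

/-- A point of the realization, from its barycentric coordinates. -/
def realization.mk (c : V → ℝ) (s : Finset V) (hs : s ∈ K.faces) (h0 : ∀ v ∉ s, c v = 0)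
    (hc : ∀ v, 0 ≤ c v) (h1 : ∑ v ∈ s, c v = 1) : realization K :=
  ⟨c, s, hs, h0, hc, h1⟩

@[simp]
theorem realization.coord_mk (c : V → ℝ) (s : Finset V) (hs : s ∈ K.faces)
    (h0 : ∀ v ∉ s, c v = 0) (hc : ∀ v, 0 ≤ c v) (h1 : ∑ v ∈ s, c v = 1) :
    (realization.mk c s hs h0 hc h1).coord = c := rfl

theorem realization.nonneg (f : realization K) (v : V) : 0 ≤ f.coord v := by
  obtain ⟨s, _, _, h, _⟩ := f.2
  exact h v

theorem realization.finite_support (f : realization K) : (Function.support f.coord).Finite := by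
  obtain ⟨s, _, h, _⟩ := f.2
  exact s.finite_toSet.subset fun v hv => by
    by_contra hvs
    exact hv (h v hvs)

/-- The support of a point of the realization: the smallest face containing it. -/
def realization.supp (f : realization K) : Finset V := f.finite_support.toFinset

theorem realization.mem_supp {f : realization K} {v : V} : v ∈ f.supp ↔ f.coord v ≠ 0 := by
  simp [realization.supp]

theorem realization.eq_zero_of_notMem {f : realization K} {v : V} (h : v ∉ f.supp) :
    f.coord v = 0 := by
  simpa [realization.mem_supp] using h

theorem realization.supp_mem (f : realization K) : f.supp ∈ K.faces := by
  obtain ⟨s, hs, h, _⟩ := f.2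
  refine K.down_closed s hs _ fun v hv => ?_
  by_contra hvs
  exact realization.mem_supp.1 hv (h v hvs)

theorem realization.sum_eq_one (f : realization K) {s : Finset V}
    (h : ∀ v ∉ s, f.coord v = 0) : ∑ v ∈ s, f.coord v = 1 := by
  obtain ⟨t, _, ht, _, h1⟩ := f.2
  change ∑ v ∈ t, f.coord v = 1 at h1
  rw [← h1, ← finsum_eq_sum_of_support_subset, ← finsum_eq_sum_of_support_subset]
  · exact fun v hv => by_contra fun hvs => hv (ht v hvs)
  · exact fun v hv => by_contra fun hvs => hv (h v hvs)

@[ext]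
theorem realization.ext {f g : realization K} (h : ∀ v, f.coord v = g.coord v) : f = g :=
  Subtype.ext (funext h)

theorem continuous_coord (v : V) : Continuous fun f : realization K => f.coord v :=
  (continuous_apply v).comp continuous_subtype_val

theorem continuous_of_coord {X : Type*} [TopologicalSpace X] {F : X → realization K}
    (h : ∀ v, Continuous fun x => (F x).coord v) : Continuous F :=
  Continuous.subtype_mk (continuous_pi h) _

/-- The total mass that a finitely supported function gives to the points satisfying `p`. -/
def mass (f : V → ℝ) (p : V → Prop) : ℝ := ∑ᶠ v, if p v then f v else 0

theorem mass_eq_sum {f : V → ℝ} {s : Finset V} (h : ∀ v ∉ s, f v = 0) (p : V → Prop) :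
    mass f p = ∑ v ∈ s, if p v then f v else 0 := by
  refine finsum_eq_sum_of_support_subset _ fun v hv => by_contra fun hvs => hv ?_
  simp [h v hvs]

theorem realization.mass_eq (f : realization K) (p : V → Prop) :
    mass f.coord p = ∑ v ∈ f.supp, if p v then f.coord v else 0 :=
  mass_eq_sum (fun _ => realization.eq_zero_of_notMem) p

theorem realization.mass_mono (f : realization K) {p q : V → Prop}
    (h : ∀ v, f.coord v ≠ 0 → p v → q v) : mass f.coord p ≤ mass f.coord q := by
  rw [f.mass_eq, f.mass_eq]
  refine Finset.sum_le_sum fun v hv => ?_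
  have := h v (realization.mem_supp.1 hv)
  have := f.nonneg v
  split_ifs <;> simp_all

theorem realization.mass_nonneg (f : realization K) (p : V → Prop) : 0 ≤ mass f.coord p := by
  rw [f.mass_eq]
  exact Finset.sum_nonneg fun v _ => by split_ifs <;> simp [f.nonneg v]

theorem realization.mass_true (f : realization K) : mass f.coord (fun _ => True) = 1 := by
  simp [f.mass_eq, f.sum_eq_one fun _ => realization.eq_zero_of_notMem]

theorem realization.mass_le_one (f : realization K) (p : V → Prop) : mass f.coord p ≤ 1 := by
  rw [← f.mass_true]
  exact f.mass_mono fun _ _ _ => trivial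

theorem realization.mass_or (f : realization K) {p q r : V → Prop}
    (h : ∀ v, r v ↔ p v ∨ q v) (hpq : ∀ v, p v → ¬ q v) :
    mass f.coord r = mass f.coord p + mass f.coord q := by
  rw [f.mass_eq, f.mass_eq, f.mass_eq, ← Finset.sum_add_distrib]
  refine Finset.sum_congr rfl fun v _ => ?_
  have := h v
  have := hpq v
  by_cases p v <;> by_cases q v <;> simp_all

theorem realization.mass_eq_single (f : realization K) (v : V) :
    mass f.coord (fun w => v = w) = f.coord v := by
  rw [f.mass_eq]
  by_cases h : v ∈ f.supp
  · simp [h]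
  · simp [h, realization.eq_zero_of_notMem h]

theorem realization.coord_le_one (f : realization K) (v : V) : f.coord v ≤ 1 := by
  rw [← f.mass_eq_single]
  exact f.mass_le_one _

theorem continuous_mass (p : V → Prop) : Continuous fun f : realization K => mass f.coord p := by
  refine continuous_iff_continuousAt.2 fun f => ?_
  have hD : Continuous fun g : realization K =>
      ∑ v ∈ f.supp, |g.coord v - f.coord v| + (1 - ∑ v ∈ f.supp, g.coord v) := by
    have := continuous_coord (K := K)
    fun_prop
  have hD0 : Filter.Tendsto (fun g : realization K =>
      ∑ v ∈ f.supp, |g.coord v - f.coord v| + (1 - ∑ v ∈ f.supp, g.coord v)) (nhds f) (nhds 0) := by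
    have := hD.tendsto f
    simpa [f.sum_eq_one fun _ => realization.eq_zero_of_notMem] using this
  rw [ContinuousAt, tendsto_iff_dist_tendsto_zero]
  refine squeeze_zero (fun _ => dist_nonneg) (fun g => ?_) hD0
  have hf : ∀ v ∉ f.supp ∪ g.supp, f.coord v = 0 := fun v hv =>
    realization.eq_zero_of_notMem fun h => hv (Finset.mem_union_left _ h)
  have hg : ∀ v ∉ f.supp ∪ g.supp, g.coord v = 0 := fun v hv =>
    realization.eq_zero_of_notMem fun h => hv (Finset.mem_union_right _ h)
  rw [Real.dist_eq, mass_eq_sum hf, mass_eq_sum hg, ← Finset.sum_sub_distrib,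
    ← g.sum_eq_one hg, ← Finset.union_sdiff_self_eq_union,
    Finset.sum_union Finset.disjoint_sdiff, Finset.sum_union Finset.disjoint_sdiff,
    add_sub_cancel_left]
  refine (abs_add_le _ _).trans (add_le_add ?_ ?_) <;>
    refine (Finset.abs_sum_le_sum_abs _ _).trans (Finset.sum_le_sum fun v hv => ?_)
  · split_ifs <;> simp
  · have := realization.eq_zero_of_notMem (Finset.mem_sdiff.1 hv).2
    have := abs_of_nonneg (g.nonneg v)
    split_ifs <;> simp [*, g.nonneg v]

/-- Two maps into a realization which pointwise share a face are homotopic. -/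
theorem homotopic_of_common_face [DecidableEq V] {X : Type*} [TopologicalSpace X]
    (F G : C(X, realization K))
    (h : ∀ x, (F x).supp ∪ (G x).supp ∈ K.faces) : F.Homotopic G := by
  have hF : ∀ x, ∀ v ∉ (F x).supp ∪ (G x).supp, (F x).coord v = 0 := fun x v hv =>
    realization.eq_zero_of_notMem fun h => hv (Finset.mem_union_left _ h)
  have hG : ∀ x, ∀ v ∉ (F x).supp ∪ (G x).supp, (G x).coord v = 0 := fun x v hv =>
    realization.eq_zero_of_notMem fun h => hv (Finset.mem_union_right _ h)
  refine ⟨⟨⟨fun tx => realization.mk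
    (fun v => (1 - tx.1.1) * (F tx.2).coord v + tx.1.1 * (G tx.2).coord v)
    _ (h tx.2) (fun v hv => ?_) (fun v => ?_) ?_, ?_⟩, fun x => ?_, fun x => ?_⟩⟩
  · simp [hF _ _ hv, hG _ _ hv]
  · have := (F tx.2).nonneg v
    have := (G tx.2).nonneg v
    have := tx.1.2.1
    have := sub_nonneg.2 tx.1.2.2
    positivity
  · rw [Finset.sum_add_distrib, ← Finset.mul_sum, ← Finset.mul_sum,
      (F tx.2).sum_eq_one (hF _), (G tx.2).sum_eq_one (hG _)]
    ring
  · refine continuous_of_coord fun v => ?_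
    simp only [realization.coord_mk]
    have ht : Continuous fun x : unitInterval × X => (x.1 : ℝ) :=
      continuous_subtype_val.comp continuous_fst
    exact ((continuous_const.sub ht).mul
      ((continuous_coord v).comp (F.continuous.comp continuous_snd))).add
      (ht.mul ((continuous_coord v).comp (G.continuous.comp continuous_snd)))
  · ext v
    simp
  · ext v
    simp

theorem sum_mass_fiber {f : V → ℝ} {s : Finset V} (h : ∀ v ∉ s, f v = 0) (φ : V → W)
    (p : W → Prop) :
    (∑ w ∈ s.image φ, if p w then mass f (fun v => φ v = w) else 0) =
      mass f (fun v => p (φ v)) := by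
  simp_rw [mass_eq_sum h]
  rw [← Finset.sum_fiberwise_of_maps_to (g := φ) (t := s.image φ)
    fun v hv => Finset.mem_image_of_mem φ hv]
  refine Finset.sum_congr rfl fun w _ => ?_
  rw [Finset.sum_filter]
  split_ifs with hw
  · refine Finset.sum_congr rfl fun v _ => ?_
    split_ifs <;> simp_all
  · refine (Finset.sum_eq_zero fun v _ => ?_).symm
    split_ifs <;> simp_all

theorem mass_fiber_eq_zero {f : V → ℝ} {s : Finset V} (h : ∀ v ∉ s, f v = 0) (φ : V → W)
    {w : W} (hw : w ∉ s.image φ) : mass f (fun v => φ v = w) = 0 := by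
  rw [mass_eq_sum h]
  refine Finset.sum_eq_zero fun v hv => if_neg ?_
  rintro rfl
  exact hw (Finset.mem_image_of_mem φ hv)

/-- The map of realizations induced by a simplicial map. -/
def realization.push (φ : V → W) (hφ : ∀ s ∈ K.faces, s.image φ ∈ L.faces)
    (f : realization K) : realization L :=
  .mk (fun w => mass f.coord (fun v => φ v = w)) (f.supp.image φ) (hφ _ f.supp_mem)
    (fun _ hw => mass_fiber_eq_zero (fun _ => realization.eq_zero_of_notMem) φ hw)
    (fun _ => f.mass_nonneg _) (by
      have := sum_mass_fiber (f := f.coord) (s := f.supp)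
        (fun _ => realization.eq_zero_of_notMem) φ (fun _ => True)
      simpa [f.mass_true] using this)

theorem realization.mass_push (φ : V → W) (hφ : ∀ s ∈ K.faces, s.image φ ∈ L.faces)
    (f : realization K) (p : W → Prop) :
    mass (f.push φ hφ).coord p = mass f.coord (fun v => p (φ v)) := by
  rw [← sum_mass_fiber (f := f.coord) (s := f.supp)
    (fun _ => realization.eq_zero_of_notMem) φ p]
  exact mass_eq_sum
    (fun w hw => mass_fiber_eq_zero (fun _ => realization.eq_zero_of_notMem) φ hw) p

theorem realization.exists_of_push_ne_zero {φ : V → W}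
    {hφ : ∀ s ∈ K.faces, s.image φ ∈ L.faces} {f : realization K} {w : W}
    (h : (f.push φ hφ).coord w ≠ 0) : ∃ v, f.coord v ≠ 0 ∧ φ v = w := by
  by_contra! hc
  refine h (mass_fiber_eq_zero (s := f.supp) (fun _ => realization.eq_zero_of_notMem) φ ?_)
  simpa [realization.mem_supp] using hc

theorem continuous_push (φ : V → W) (hφ : ∀ s ∈ K.faces, s.image φ ∈ L.faces) :
    Continuous (realization.push φ hφ) :=
  continuous_of_coord fun _ => continuous_mass _

end AbsSC

open AbsSC

theorem image_mem_orderComplex {A : Type u} {B : Type v} [Preorder A] [Preorder B] [DecidableEq B]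
    {φ : A → B} (hφ : Monotone φ) :
    ∀ s ∈ (orderComplex A).faces, s.image φ ∈ (orderComplex B).faces := by
  intro s hs
  change IsChain _ _
  rw [Finset.coe_image]
  rintro _ ⟨x, hx, rfl⟩ _ ⟨y, hy, rfl⟩ _
  exact (hs.total hx hy).imp (fun h => hφ h) (fun h => hφ h)

section Coupling

variable {A : Type u} {B : Type v} [PartialOrder A] [PartialOrder B]

theorem sum_telescope_chain (φ : ℝ → ℝ) (a : A → ℝ) (s : Finset A)
    (hs : IsChain (· ≤ ·) (s : Set A)) :
    ∑ x ∈ s, (φ (∑ z ∈ s, if x ≤ z then a z else 0) - φ (∑ z ∈ s, if x < z then a z else 0)) =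
      φ (∑ z ∈ s, a z) - φ 0 := by
  induction hn : s.card generalizing s with
  | zero => simp [Finset.card_eq_zero.1 hn]
  | succ n ih =>
    have hne : s.Nonempty := Finset.card_pos.1 (by omega)
    obtain ⟨m, hm⟩ := s.exists_minimal hne
    have hlt : ∀ z ∈ s.erase m, m < z := fun z hz => by
      obtain ⟨hzm, hzs⟩ := Finset.mem_erase.1 hz
      rcases hs.total hm.1 hzs with h | h
      · exact lt_of_le_of_ne h hzm.symm
      · exact absurd (le_antisymm h (hm.2 hzs h)) hzm
    have ih' := ih (s.erase m) (hs.mono (by simp)) (by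
      rw [Finset.card_erase_of_mem hm.1, hn]; rfl)
    rw [← Finset.insert_erase hm.1, Finset.sum_insert (Finset.notMem_erase m s)]
    have h1 : ∑ x ∈ s.erase m, (φ (∑ z ∈ insert m (s.erase m), if x ≤ z then a z else 0)
        - φ (∑ z ∈ insert m (s.erase m), if x < z then a z else 0)) =
        φ (∑ z ∈ s.erase m, a z) - φ 0 := by
      rw [← ih']
      refine Finset.sum_congr rfl fun x hx => ?_
      rw [Finset.sum_insert (Finset.notMem_erase m s),
        Finset.sum_insert (Finset.notMem_erase m s), if_neg (hlt x hx).not_ge,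
        if_neg (hlt x hx).not_gt, zero_add, zero_add]
    have h2 : (∑ z ∈ insert m (s.erase m), if m ≤ z then a z else 0) =
        ∑ z ∈ insert m (s.erase m), a z := by
      refine Finset.sum_congr rfl fun z hz => if_pos ?_
      rcases Finset.mem_insert.1 hz with rfl | hz
      · exact le_rfl
      · exact (hlt z hz).le
    have h3 : (∑ z ∈ insert m (s.erase m), if m < z then a z else 0) =
        ∑ z ∈ s.erase m, a z := by
      rw [Finset.sum_insert (Finset.notMem_erase m s), if_neg (lt_irrefl m), zero_add]
      exact Finset.sum_congr rfl fun z hz => if_pos (hlt z hz)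
    rw [h1, h2, h3]
    ring

theorem mass_le_eq (a : realization (orderComplex A)) (x : A) :
    mass a.coord (x ≤ ·) = mass a.coord (x < ·) + a.coord x := by
  rw [← a.mass_eq_single x]
  exact a.mass_or (fun v => le_iff_lt_or_eq) fun v h => h.ne

theorem mass_le_of_lt (a : realization (orderComplex A)) {x y : A} (h : x < y) :
    mass a.coord (y ≤ ·) ≤ mass a.coord (x < ·) :=
  a.mass_mono fun _ _ hv => h.trans_le hv

theorem comparable_of_ne_zero {a : realization (orderComplex A)} {x y : A} (hx : a.coord x ≠ 0)
    (hy : a.coord y ≠ 0) : x ≤ y ∨ y ≤ x :=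
  IsChain.total a.supp_mem (realization.mem_supp.2 hx) (realization.mem_supp.2 hy)

/-- The comonotone coupling of two functions: the overlap of the intervals
occupied by `x` and `y` in the upper cumulative distributions. -/
def coupling (a : A → ℝ) (b : B → ℝ) (z : A × B) : ℝ :=
  max 0 (min (mass a (z.1 ≤ ·)) (mass b (z.2 ≤ ·)) - max (mass a (z.1 < ·)) (mass b (z.2 < ·)))

theorem coupling_swap (a : A → ℝ) (b : B → ℝ) (x : A) (y : B) :
    coupling a b (x, y) = coupling b a (y, x) := by
  simp only [coupling, min_comm, max_comm]

theorem coupling_ne_zero {a : A → ℝ} {b : B → ℝ} {z : A × B} (h : coupling a b z ≠ 0) :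
    mass a (z.1 < ·) < mass a (z.1 ≤ ·) ∧ mass a (z.1 < ·) < mass b (z.2 ≤ ·) ∧
      mass b (z.2 < ·) < mass a (z.1 ≤ ·) ∧ mass b (z.2 < ·) < mass b (z.2 ≤ ·) := by
  have h' : max (mass a (z.1 < ·)) (mass b (z.2 < ·)) <
      min (mass a (z.1 ≤ ·)) (mass b (z.2 ≤ ·)) := by
    by_contra! hc
    exact h (max_eq_left (sub_nonpos.2 hc))
  simp only [max_lt_iff, lt_min_iff] at h'
  tauto

variable (a : realization (orderComplex A)) (b : realization (orderComplex B))

theorem coupling_eq_zero_left {z : A × B} (h : a.coord z.1 = 0) :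
    coupling a.coord b.coord z = 0 := by
  by_contra hc
  have := (coupling_ne_zero hc).1
  rw [mass_le_eq, h] at this
  simp at this

theorem coupling_eq_zero_right {z : A × B} (h : b.coord z.2 = 0) :
    coupling a.coord b.coord z = 0 := by
  rw [coupling_swap]
  exact coupling_eq_zero_left b a (z := (z.2, z.1)) h

theorem sum_coupling_left (y : B) : ∑ x ∈ a.supp, coupling a.coord b.coord (x, y) = b.coord y := by
  have hb := mass_le_eq b y
  have hy := b.nonneg y
  have h := sum_telescope_chain
    (fun u => max (mass b.coord (y < ·)) (min (mass b.coord (y ≤ ·)) u)) a.coord a.supp a.supp_mem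
  simp only [← a.mass_eq] at h
  rw [a.sum_eq_one fun _ => realization.eq_zero_of_notMem,
    min_eq_left (b.mass_le_one _), min_eq_right (b.mass_nonneg _),
    max_eq_left (b.mass_nonneg _), max_eq_right (by linarith)] at h
  have key : b.coord y = mass b.coord (y ≤ ·) - mass b.coord (y < ·) := by linarith
  rw [key, ← h]
  refine Finset.sum_congr rfl fun x _ => ?_
  have ha := mass_le_eq a x
  have hx := a.nonneg x
  simp only [coupling]
  generalize mass a.coord (x ≤ ·) = F at *
  generalize mass a.coord (x < ·) = F' at *
  generalize mass b.coord (y ≤ ·) = G at *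
  generalize mass b.coord (y < ·) = G' at *
  grind

theorem sum_coupling_right (x : A) : ∑ y ∈ b.supp, coupling a.coord b.coord (x, y) = a.coord x := by
  simp_rw [coupling_swap a.coord b.coord]
  exact sum_coupling_left b a x

theorem comparable_of_coupling_ne_zero {z w : A × B} (hz : coupling a.coord b.coord z ≠ 0)
    (hw : coupling a.coord b.coord w ≠ 0) : z ≤ w ∨ w ≤ z := by
  have ha := comparable_of_ne_zero (fun h => hz (coupling_eq_zero_left a b h))
    (fun h => hw (coupling_eq_zero_left a b h))
  have hb := comparable_of_ne_zero (fun h => hz (coupling_eq_zero_right a b h))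
    (fun h => hw (coupling_eq_zero_right a b h))
  obtain ⟨-, h1, h2, -⟩ := coupling_ne_zero hz
  obtain ⟨-, h3, h4, -⟩ := coupling_ne_zero hw
  by_contra! hc
  simp only [Prod.le_def, not_and_or] at hc
  obtain ⟨hzw, hwz⟩ := hc
  rcases ha with ha | ha
  · have hb' : w.2 < z.2 := by
      rcases hb with hb | hb
      · exact absurd hzw (by simp [ha, hb])
      · exact lt_of_le_of_ne hb fun h => by simp [ha, h] at hzw
    have ha' : z.1 < w.1 := lt_of_le_of_ne ha fun h => by simp [hb'.le, h] at hwz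
    linarith [mass_le_of_lt a ha', mass_le_of_lt b hb']
  · have hb' : z.2 < w.2 := by
      rcases hb with hb | hb
      · exact lt_of_le_of_ne hb fun h => by simp [ha, h] at hwz
      · exact absurd hwz (by simp [ha, hb])
    have ha' : w.1 < z.1 := lt_of_le_of_ne ha fun h => by simp [hb'.le, h] at hzw
    linarith [mass_le_of_lt a ha', mass_le_of_lt b hb']

theorem continuous_coupling (z : A × B) :
    Continuous fun ab : realization (orderComplex A) × realization (orderComplex B) =>
      coupling ab.1.coord ab.2.coord z := by
  have h1 (p : A → Prop) : Continuous
      fun ab : realization (orderComplex A) × realization (orderComplex B) =>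
        mass ab.1.coord p := (continuous_mass p).comp continuous_fst
  have h2 (p : B → Prop) : Continuous
      fun ab : realization (orderComplex A) × realization (orderComplex B) =>
        mass ab.2.coord p := (continuous_mass p).comp continuous_snd
  exact continuous_const.max (((h1 _).min (h2 _)).sub ((h1 _).max (h2 _)))

variable {r : A × B → Prop}

theorem sum_coupling_subtype (hr : ∀ z, ¬ r z → coupling a.coord b.coord z = 0)
    (p : A × B → Prop) :
    (∑ z ∈ (a.supp ×ˢ b.supp).subtype r, if p z then coupling a.coord b.coord z else 0) =
      ∑ x ∈ a.supp, ∑ y ∈ b.supp, if p (x, y) then coupling a.coord b.coord (x, y) else 0 := by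
  rw [Finset.sum_subtype_eq_sum_filter
    (f := fun z => if p z then coupling a.coord b.coord z else 0), Finset.sum_filter_of_ne,
    Finset.sum_product]
  intro z _ hz
  by_contra h
  exact hz (by simp [hr z h])

theorem coupling_eq_zero_of_notMem {z : {z // r z}}
    (hz : z ∉ (a.supp ×ˢ b.supp).subtype r) : coupling a.coord b.coord z = 0 := by
  simp only [Finset.mem_subtype, Finset.mem_product, not_and_or] at hz
  rcases hz with hz | hz
  · exact coupling_eq_zero_left a b (realization.eq_zero_of_notMem hz)
  · exact coupling_eq_zero_right a b (realization.eq_zero_of_notMem hz)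

/-- The comonotone coupling as a point of the order complex of a subposet of the product
that contains its support. -/
def couple (hr : ∀ z, ¬ r z → coupling a.coord b.coord z = 0) :
    realization (orderComplex {z // r z}) :=
  .mk (fun z => coupling a.coord b.coord z)
    {z ∈ (a.supp ×ˢ b.supp).subtype r | coupling a.coord b.coord z ≠ 0}
    (fun z hz w hw _ =>
      comparable_of_coupling_ne_zero a b (Finset.mem_filter.1 hz).2 (Finset.mem_filter.1 hw).2)
    (fun z hz => by
      by_contra h
      exact hz (Finset.mem_filter.2
        ⟨by_contra fun h' => h (coupling_eq_zero_of_notMem a b h'), h⟩))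
    (fun _ => le_max_left _ _) (by
      rw [Finset.sum_filter_ne_zero]
      have := sum_coupling_subtype a b hr (fun _ => True)
      simp only [if_true] at this
      rw [this]
      simp_rw [sum_coupling_right]
      exact a.sum_eq_one fun _ => realization.eq_zero_of_notMem)

theorem mass_couple (hr : ∀ z, ¬ r z → coupling a.coord b.coord z = 0) (p : A × B → Prop) :
    mass (couple a b hr).coord (fun z => p z) =
      ∑ x ∈ a.supp, ∑ y ∈ b.supp, if p (x, y) then coupling a.coord b.coord (x, y) else 0 := by
  rw [← sum_coupling_subtype a b hr]
  exact mass_eq_sum (fun z hz => coupling_eq_zero_of_notMem a b hz) _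

variable (r) in
/-- The first marginal of a point of the order complex of a subposet of a product. -/
def marginalFst : realization (orderComplex {z // r z}) → realization (orderComplex A) :=
  .push (fun z => z.1.1) (image_mem_orderComplex fun _ _ h => h.1)

variable (r) in
/-- The second marginal of a point of the order complex of a subposet of a product. -/
def marginalSnd : realization (orderComplex {z // r z}) → realization (orderComplex B) :=
  .push (fun z => z.1.2) (image_mem_orderComplex fun _ _ h => h.2)

theorem marginalFst_couple (hr : ∀ z, ¬ r z → coupling a.coord b.coord z = 0) :
    marginalFst r (couple a b hr) = a := by
  ext x
  refine (mass_couple a b hr (fun z => z.1 = x)).trans ?_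
  by_cases hx : x ∈ a.supp
  · rw [Finset.sum_eq_single_of_mem x hx fun x' _ h => by simp [h]]
    simp [sum_coupling_right]
  · rw [realization.eq_zero_of_notMem hx]
    refine Finset.sum_eq_zero fun x' hx' => Finset.sum_eq_zero fun y _ => if_neg ?_
    rintro rfl
    exact hx hx'

theorem marginalSnd_couple (hr : ∀ z, ¬ r z → coupling a.coord b.coord z = 0) :
    marginalSnd r (couple a b hr) = b := by
  ext y
  refine (mass_couple a b hr (fun z => z.2 = y)).trans ?_
  rw [Finset.sum_comm]
  by_cases hy : y ∈ b.supp
  · rw [Finset.sum_eq_single_of_mem y hy fun y' _ h => by simp [h]]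
    simp [sum_coupling_left]
  · rw [realization.eq_zero_of_notMem hy]
    refine Finset.sum_eq_zero fun y' hy' => Finset.sum_eq_zero fun x _ => if_neg ?_
    rintro rfl
    exact hy hy'

theorem comparable_coupling_marginals (f : realization (orderComplex {z // r z}))
    {z w : {z // r z}} (hw : f.coord w ≠ 0)
    (hz : coupling (marginalFst r f).coord (marginalSnd r f).coord z ≠ 0) : z ≤ w ∨ w ≤ z := by
  have hcmp : ∀ v, f.coord v ≠ 0 → v ≤ w ∨ w ≤ v := fun v hv => comparable_of_ne_zero hv hw
  obtain ⟨z₁, hz₁, hz₁'⟩ := realization.exists_of_push_ne_zero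
    fun h => hz (coupling_eq_zero_left _ _ h)
  obtain ⟨z₂, hz₂, hz₂'⟩ := realization.exists_of_push_ne_zero
    fun h => hz (coupling_eq_zero_right _ _ h)
  have ha : z.1.1 ≤ w.1.1 ∨ w.1.1 ≤ z.1.1 := by
    rw [← hz₁']
    exact (hcmp _ hz₁).imp (fun h => h.1) (fun h => h.1)
  have hb : z.1.2 ≤ w.1.2 ∨ w.1.2 ≤ z.1.2 := by
    rw [← hz₂']
    exact (hcmp _ hz₂).imp (fun h => h.2) (fun h => h.2)
  obtain ⟨-, h1, h2, -⟩ := coupling_ne_zero hz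
  simp only [marginalFst, marginalSnd, realization.mass_push] at h1 h2
  by_contra! hc
  obtain ⟨hzw, hwz⟩ := hc
  have hzw' : ¬ (z.1.1 ≤ w.1.1 ∧ z.1.2 ≤ w.1.2) := hzw
  have hwz' : ¬ (w.1.1 ≤ z.1.1 ∧ w.1.2 ≤ z.1.2) := hwz
  by_cases h : z.1.1 ≤ w.1.1
  · have hzw₂ : ¬ z.1.2 ≤ w.1.2 := fun h' => hzw' ⟨h, h'⟩
    have hwz₁ : ¬ w.1.1 ≤ z.1.1 := fun h' => hwz' ⟨h', hb.resolve_left hzw₂⟩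
    refine h1.not_ge (f.mass_mono fun v hv hvz => ?_)
    rcases hcmp v hv with h' | h'
    · exact absurd (le_trans hvz h'.2) hzw₂
    · exact lt_of_lt_of_le (lt_of_le_not_ge h hwz₁) h'.1
  · have hwz₂ : ¬ w.1.2 ≤ z.1.2 := fun h' => hwz' ⟨ha.resolve_left h, h'⟩
    refine h2.not_ge (f.mass_mono fun v hv hvz => ?_)
    rcases hcmp v hv with h' | h'
    · exact absurd (le_trans hvz h'.1) h
    · exact lt_of_lt_of_le (lt_of_le_not_ge (hb.resolve_right hwz₂) hwz₂) h'.2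

end Coupling

section Bot

variable (P : Type u) (Q : Type v) [PartialOrder P] [PartialOrder Q]

/-- The pairs of points of the two cones at least one of which lies in the base of its cone:
the base of the product of the cones. -/
def ConeBoundary : Type (max u v) :=
  {ab : realization (orderComplex (WithBot P)) × realization (orderComplex (WithBot Q)) //
    ab.1.coord ⊥ = 0 ∨ ab.2.coord ⊥ = 0}

instance : TopologicalSpace (ConeBoundary P Q) :=
  inferInstanceAs (TopologicalSpace {_ab : _ × _ // _})

variable {P Q}

theorem coupling_bot_eq_zero (ab : ConeBoundary P Q) (z : WithBot P × WithBot Q)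
    (hz : ¬ z ≠ (⊥, ⊥)) : coupling ab.1.1.coord ab.1.2.coord z = 0 := by
  obtain rfl := not_not.1 hz
  rcases ab.2 with h | h
  · exact coupling_eq_zero_left _ _ h
  · exact coupling_eq_zero_right _ _ h

theorem marginal_bot_eq_zero
    (f : realization (orderComplex {x : WithBot P × WithBot Q // x ≠ (⊥, ⊥)})) :
    (marginalFst _ f).coord ⊥ = 0 ∨ (marginalSnd _ f).coord ⊥ = 0 := by
  by_contra! h
  obtain ⟨z, hz, hz'⟩ := realization.exists_of_push_ne_zero h.1
  obtain ⟨w, hw, hw'⟩ := realization.exists_of_push_ne_zero h.2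
  rcases comparable_of_ne_zero hz hw with h' | h'
  · exact z.2 (Prod.ext hz' (le_bot_iff.1 (h'.2.trans_eq hw')))
  · exact w.2 (Prod.ext (le_bot_iff.1 (h'.1.trans_eq hz')) hw')

variable (P Q) in
/-- Marginals and comonotone couplings are mutually inverse up to homotopy. -/
def marginalsEquiv : ContinuousMap.HomotopyEquiv
    (realization (orderComplex {x : WithBot P × WithBot Q // x ≠ (⊥, ⊥)}))
    (ConeBoundary P Q) where
  toFun := ⟨fun f => ⟨(marginalFst _ f, marginalSnd _ f), marginal_bot_eq_zero f⟩,
    ((continuous_push _ _).prodMk (continuous_push _ _)).subtype_mk _⟩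
  invFun := ⟨fun ab => couple ab.1.1 ab.1.2 (coupling_bot_eq_zero ab),
    continuous_of_coord fun z => (continuous_coupling z.1).comp continuous_subtype_val⟩
  left_inv := by
    refine homotopic_of_common_face _ _ fun f z hz w hw _ => ?_
    rcases Finset.mem_union.1 hz with hz | hz <;> rcases Finset.mem_union.1 hw with hw | hw <;>
      rw [realization.mem_supp] at hz hw
    · exact comparable_of_coupling_ne_zero _ _ hz hw
    · exact comparable_coupling_marginals f hw hz
    · exact (comparable_coupling_marginals f hz hw).symm
    · exact comparable_of_ne_zero hz hw
  right_inv := by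
    refine Eq.subst (motive := fun F : C(ConeBoundary P Q, ConeBoundary P Q) =>
      F.Homotopic (.id _)) ?_ (.refl _)
    refine ContinuousMap.ext fun ab => Subtype.ext (Prod.ext ?_ ?_)
    · exact (marginalFst_couple ab.1.1 ab.1.2 (coupling_bot_eq_zero ab)).symm
    · exact (marginalSnd_couple ab.1.1 ab.1.2 (coupling_bot_eq_zero ab)).symm

/-- The point of the cone with given coordinates in the base. -/
def extendBot (c : P → ℝ) (s : Finset P) (hs : s ∈ (orderComplex P).faces)
    (h0 : ∀ v ∉ s, c v = 0) (hc : ∀ v, 0 ≤ c v) (t : ℝ) (ht : ∑ v ∈ s, c v = t) (h1 : t ≤ 1) :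
    realization (orderComplex (WithBot P)) :=
  .mk (WithBot.recBotCoe (1 - t) c) (insert ⊥ (s.image (↑)))
    (by
      change IsChain _ _
      rw [Finset.coe_insert]
      exact IsChain.insert (image_mem_orderComplex WithBot.coe_mono s hs)
        fun _ _ _ => Or.inl bot_le)
    (fun v hv => by
      induction v with
      | bot => simp at hv
      | coe v => exact h0 v fun h => hv (by simp [h]))
    (fun v => by
      induction v with
      | bot => simpa using h1
      | coe v => exact hc v)
    (by
      rw [Finset.sum_insert (by simp), Finset.sum_image fun _ _ _ _ h => WithBot.coe_injective h]
      simp [ht])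

theorem sum_coord_coe (a : realization (orderComplex (WithBot P))) :
    ∑ x ∈ a.supp.preimage WithBot.some WithBot.coe_injective.injOn, a.coord (x : WithBot P) =
      1 - a.coord ⊥ := by
  have := a.sum_eq_one (s := insert ⊥
    ((a.supp.preimage WithBot.some WithBot.coe_injective.injOn).image
      (fun x : P => (x : WithBot P))))
    (fun v hv => by
      induction v with
      | bot => simp at hv
      | coe v =>
        refine realization.eq_zero_of_notMem fun h => hv ?_
        simp [h])
  rw [Finset.sum_insert (by simp), Finset.sum_image fun _ _ _ _ h => WithBot.coe_injective h]
    at this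
  linarith

section Join

variable (g : realization (joinComplex (orderComplex P) (orderComplex Q)))

theorem sum_coord_toLeft :
    ∑ x ∈ g.supp.toLeft, g.coord (.inl x) = mass g.coord (fun v => v.isLeft) := by
  rw [g.mass_eq, ← Finset.toLeft_disjSum_toRight (u := g.supp), Finset.sum_disjSum]
  simp

theorem sum_coord_toRight :
    ∑ y ∈ g.supp.toRight, g.coord (.inr y) = mass g.coord (fun v => v.isRight) := by
  rw [g.mass_eq, ← Finset.toLeft_disjSum_toRight (u := g.supp), Finset.sum_disjSum]
  simp

theorem mass_isLeft_add_mass_isRight :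
    mass g.coord (fun v => v.isLeft) + mass g.coord (fun v => v.isRight) = 1 := by
  rw [← g.mass_true]
  exact (g.mass_or (by simp) (by simp)).symm

/-- The larger of the weights of the two factors at a point of a join. -/
def maxWeight : ℝ := max (mass g.coord (fun v => v.isLeft)) (mass g.coord (fun v => v.isRight))

theorem maxWeight_pos : 0 < maxWeight g := by
  have := mass_isLeft_add_mass_isRight g
  by_contra! h
  have := max_le_iff.1 h
  linarith

/-- Rescale a point of the join so that the larger of the two weights becomes one. -/
def joinToConeBoundary : ConeBoundary P Q :=
  ⟨(extendBot (fun x => g.coord (.inl x) / maxWeight g) g.supp.toLeft g.supp_mem.1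
      (fun v hv => by
        rw [realization.eq_zero_of_notMem (by simpa using hv), zero_div])
      (fun v => div_nonneg (g.nonneg _) (maxWeight_pos g).le)
      (mass g.coord (fun v => v.isLeft) / maxWeight g)
      (by rw [← Finset.sum_div, sum_coord_toLeft])
      ((div_le_one (maxWeight_pos g)).2 (le_max_left _ _)),
    extendBot (fun y => g.coord (.inr y) / maxWeight g) g.supp.toRight g.supp_mem.2
      (fun v hv => by
        rw [realization.eq_zero_of_notMem (by simpa using hv), zero_div])
      (fun v => div_nonneg (g.nonneg _) (maxWeight_pos g).le)
      (mass g.coord (fun v => v.isRight) / maxWeight g)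
      (by rw [← Finset.sum_div, sum_coord_toRight])
      ((div_le_one (maxWeight_pos g)).2 (le_max_right _ _))), by
    refine (max_choice (mass g.coord (fun v => v.isLeft))
      (mass g.coord (fun v => v.isRight))).imp (fun h => ?_) (fun h => ?_) <;>
    · have := maxWeight_pos g
      refine sub_eq_zero.2 (Eq.symm ?_)
      rw [maxWeight, h, div_self]
      rw [← h]
      exact this.ne'⟩

theorem continuous_maxWeight : Continuous (maxWeight (P := P) (Q := Q)) :=
  (continuous_mass _).max (continuous_mass _)

theorem continuous_joinToConeBoundary :
    Continuous (joinToConeBoundary (P := P) (Q := Q)) := by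
  have hc (v : P ⊕ Q) := (continuous_coord (K := joinComplex (orderComplex P) (orderComplex Q))
    v).div continuous_maxWeight fun g => (maxWeight_pos g).ne'
  have hm (p : P ⊕ Q → Prop) := continuous_const (y := (1 : ℝ)).sub
    ((continuous_mass (K := joinComplex (orderComplex P) (orderComplex Q)) p).div
      continuous_maxWeight fun g => (maxWeight_pos g).ne')
  refine Continuous.subtype_mk (Continuous.prodMk ?_ ?_) _ <;>
    refine continuous_of_coord fun v => ?_
  · induction v with
    | bot => exact hm _
    | coe v => exact hc (.inl v)
  · induction v with
    | bot => exact hm _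
    | coe v => exact hc (.inr v)

/-- The total weight in the bases of the two cones. -/
def baseWeight (ab : ConeBoundary P Q) : ℝ := 2 - ab.1.1.coord ⊥ - ab.1.2.coord ⊥

theorem baseWeight_pos (ab : ConeBoundary P Q) : 0 < baseWeight ab := by
  have h1 := ab.1.1.coord_le_one ⊥
  have h2 := ab.1.2.coord_le_one ⊥
  rw [baseWeight]
  rcases ab.2 with h | h <;> rw [h] <;> linarith

/-- Rescale a point of the base of the product of the cones so that the total weight in the bases
of the two cones becomes one. -/
def coneBoundaryToJoin (ab : ConeBoundary P Q) :
    realization (joinComplex (orderComplex P) (orderComplex Q)) :=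
  .mk (fun v => Sum.elim (fun x : P => ab.1.1.coord x) (fun y : Q => ab.1.2.coord y) v /
      baseWeight ab)
    ((ab.1.1.supp.preimage WithBot.some WithBot.coe_injective.injOn).disjSum
      (ab.1.2.supp.preimage WithBot.some WithBot.coe_injective.injOn))
    (by
      constructor
      · rw [Finset.toLeft_disjSum]
        intro x hx y hy _
        simp only [Finset.coe_preimage, Set.mem_preimage, SetLike.mem_coe,
          realization.mem_supp] at hx hy
        simpa using comparable_of_ne_zero hx hy
      · rw [Finset.toRight_disjSum]
        intro x hx y hy _
        simp only [Finset.coe_preimage, Set.mem_preimage, SetLike.mem_coe,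
          realization.mem_supp] at hx hy
        simpa using comparable_of_ne_zero hx hy)
    (fun v hv => by
      rw [div_eq_zero_iff]
      refine Or.inl ?_
      cases v with
      | inl v => exact realization.eq_zero_of_notMem (by simpa using hv)
      | inr v => exact realization.eq_zero_of_notMem (by simpa using hv))
    (fun v => by
      refine div_nonneg ?_ (baseWeight_pos ab).le
      cases v <;> exact realization.nonneg _ _)
    (by
      rw [← Finset.sum_div, Finset.sum_disjSum, div_eq_one_iff_eq (baseWeight_pos ab).ne']
      simp only [Sum.elim_inl, Sum.elim_inr]
      rw [sum_coord_coe, sum_coord_coe, baseWeight]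
      ring)

theorem continuous_coneBoundaryToJoin :
    Continuous (coneBoundaryToJoin (P := P) (Q := Q)) := by
  have h1 (v : WithBot P) : Continuous fun ab : ConeBoundary P Q => ab.1.1.coord v :=
    (continuous_coord v).comp (continuous_fst.comp continuous_subtype_val)
  have h2 (v : WithBot Q) : Continuous fun ab : ConeBoundary P Q => ab.1.2.coord v :=
    (continuous_coord v).comp (continuous_snd.comp continuous_subtype_val)
  have h3 : Continuous (baseWeight (P := P) (Q := Q)) :=
    (continuous_const.sub (h1 ⊥)).sub (h2 ⊥)
  refine continuous_of_coord fun v => ?_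
  cases v with
  | inl v => exact (h1 v).div h3 fun ab => (baseWeight_pos ab).ne'
  | inr v => exact (h2 v).div h3 fun ab => (baseWeight_pos ab).ne'

theorem baseWeight_joinToConeBoundary :
    baseWeight (joinToConeBoundary g) = 1 / maxWeight g := by
  have h := mass_isLeft_add_mass_isRight g
  change 2 - (1 - mass g.coord (fun v => v.isLeft) / maxWeight g) -
    (1 - mass g.coord (fun v => v.isRight) / maxWeight g) = _
  have h' : mass g.coord (fun v => v.isLeft) / maxWeight g +
      mass g.coord (fun v => v.isRight) / maxWeight g = 1 / maxWeight g := by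
    rw [← add_div, h]
  linarith

theorem coneBoundaryToJoin_joinToConeBoundary :
    coneBoundaryToJoin (joinToConeBoundary g) = g := by
  have hm := (maxWeight_pos g).ne'
  ext v
  cases v with
  | inl v =>
    change g.coord (.inl v) / maxWeight g / baseWeight (joinToConeBoundary g) = _
    rw [baseWeight_joinToConeBoundary]
    field_simp
  | inr v =>
    change g.coord (.inr v) / maxWeight g / baseWeight (joinToConeBoundary g) = _
    rw [baseWeight_joinToConeBoundary]
    field_simp

end Join

theorem mass_isLeft_coneBoundaryToJoin (ab : ConeBoundary P Q) :
    mass (coneBoundaryToJoin ab).coord (fun v => v.isLeft) =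
      (1 - ab.1.1.coord ⊥) / baseWeight ab := by
  rw [← sum_coord_coe, mass_eq_sum
      (s := (ab.1.1.supp.preimage WithBot.some WithBot.coe_injective.injOn).disjSum
        (ab.1.2.supp.preimage WithBot.some WithBot.coe_injective.injOn)),
    Finset.sum_disjSum, Finset.sum_div]
  · simp only [Sum.isLeft_inl, Sum.isLeft_inr, Bool.false_eq_true, if_true, if_false,
      Finset.sum_const_zero, add_zero]
    rfl
  · rintro (v | v) hv
    · refine div_eq_zero_iff.2 (.inl ?_)
      exact realization.eq_zero_of_notMem (by simpa using hv)
    · refine div_eq_zero_iff.2 (.inl ?_)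
      exact realization.eq_zero_of_notMem (by simpa using hv)

theorem mass_isRight_coneBoundaryToJoin (ab : ConeBoundary P Q) :
    mass (coneBoundaryToJoin ab).coord (fun v => v.isRight) =
      (1 - ab.1.2.coord ⊥) / baseWeight ab := by
  have h := mass_isLeft_add_mass_isRight (coneBoundaryToJoin ab)
  have hb := (baseWeight_pos ab).ne'
  rw [mass_isLeft_coneBoundaryToJoin] at h
  rw [eq_sub_of_add_eq' h, baseWeight] at *
  field_simp
  ring

theorem maxWeight_coneBoundaryToJoin (ab : ConeBoundary P Q) :
    maxWeight (coneBoundaryToJoin ab) = 1 / baseWeight ab := by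
  rw [maxWeight, mass_isLeft_coneBoundaryToJoin, mass_isRight_coneBoundaryToJoin,
    max_div_div_right (baseWeight_pos ab).le]
  congr 1
  have h1 := ab.1.1.nonneg ⊥
  have h2 := ab.1.2.nonneg ⊥
  rcases ab.2 with h | h
  · rw [h, sub_zero]
    exact max_eq_left (by linarith)
  · rw [h, sub_zero]
    exact max_eq_right (by linarith)

theorem joinToConeBoundary_coneBoundaryToJoin (ab : ConeBoundary P Q) :
    joinToConeBoundary (coneBoundaryToJoin ab) = ab := by
  have hb := (baseWeight_pos ab).ne'
  refine Subtype.ext (Prod.ext (realization.ext fun v => ?_) (realization.ext fun v => ?_)) <;>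
    cases v
  · change 1 - mass _ _ / maxWeight _ = _
    rw [mass_isLeft_coneBoundaryToJoin, maxWeight_coneBoundaryToJoin]
    field_simp
    ring
  · change ab.1.1.coord _ / baseWeight ab / maxWeight _ = _
    rw [maxWeight_coneBoundaryToJoin]
    field_simp
  · change 1 - mass _ _ / maxWeight _ = _
    rw [mass_isRight_coneBoundaryToJoin, maxWeight_coneBoundaryToJoin]
    field_simp
    ring
  · change ab.1.2.coord _ / baseWeight ab / maxWeight _ = _
    rw [maxWeight_coneBoundaryToJoin]
    field_simp

variable (P Q) in
/-- The base of the product of two cones is homeomorphic to the join of their bases. -/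
def coneBoundaryHomeomorph : ConeBoundary P Q ≃ₜ
    realization (joinComplex (orderComplex P) (orderComplex Q)) where
  toFun := coneBoundaryToJoin
  invFun := joinToConeBoundary
  left_inv := joinToConeBoundary_coneBoundaryToJoin
  right_inv := coneBoundaryToJoin_joinToConeBoundary
  continuous_toFun := continuous_coneBoundaryToJoin
  continuous_invFun := continuous_joinToConeBoundary

end Bot


/-- Let `P` and `Q` be posets whose order complexes are
homotopy equivalent to wedges of spheres of dimensions `p` and `q`. Let
`R = ((P ∪ {0̂}) × (Q ∪ {0̂})) ∖ {(0̂, 0̂)}` (componentwise order). Then the order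
complex of `R` is homotopy equivalent to the join of the order complexes of `P`
and `Q`. -/
theorem product_poset_join
    {P : Type u} {Q : Type v} [PartialOrder P] [PartialOrder Q]
    (p q : ℤ) (hp : 0 ≤ p) (hq : 0 ≤ q)
    (hP : IsWedgeOfSpheres p (AbsSC.realization (orderComplex P)))
    (hQ : IsWedgeOfSpheres q (AbsSC.realization (orderComplex Q))) :
    Nonempty (ContinuousMap.HomotopyEquiv
      (AbsSC.realization (orderComplex
        {x : WithBot P × WithBot Q // x ≠ (⊥, ⊥)}))
      (AbsSC.realization
        (joinComplex (orderComplex P) (orderComplex Q)))) := by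
  exact ⟨(marginalsEquiv P Q).trans (coneBoundaryHomeomorph P Q).toHomotopyEquiv⟩
end
end
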